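/- Let δ := γ/(γ+1). There exist constants C > 0 and P₀ ≥ 1 such that for all sufficiently small ε > 0, all α̃ with |α̃| < ε^{−1/2}a, and all q ∈ [0,1): |Ψ_l(α̃, p̂, q)| ≤ C |p̂|^{−3/2} for every p̂ ≤ −P₀, and |Ψ_l(α̃, p̂, q)| ≤ C p̂^{−(1+δ)/2} for every p̂ ≥ P₀. The constants are uniform with respect to α̃, q in the indicated sets and ε > 0 sufficiently small. -/

import Mathlib

open MeasureTheory Filter Topology

/-- A differentiable function with essentially bounded derivative is Lipschitz. -/
lemma abs_sub_le_of_ae_abs_deriv_le {f : ℝ → ℝ} (hd : ∀ x, DifferentiableAt ℝ f x) {M : ℝ}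
    (hM : ∀ᵐ x : ℝ, |deriv f x| ≤ M) (x y : ℝ) : |f x - f y| ≤ M * |x - y| := by
  have hint : IntervalIntegrable (deriv f) volume y x := by
    refine (intervalIntegrable_const (c := M)).mono_fun'
      (measurable_deriv f).aestronglyMeasurable ?_
    exact ae_restrict_of_ae (by simpa using hM)
  rw [← intervalIntegral.integral_eq_sub_of_hasDerivAt (fun z _ => (hd z).hasDerivAt) hint]
  simpa using intervalIntegral.norm_integral_le_of_norm_le_const_ae
    (f := deriv f) (a := y) (b := x) (C := M) (hM.mono fun z hz _ => by simpa using hz)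

/-- The truncated singular integral of the kernel `1 / (t - s)` over a symmetric annulus around
`t` vanishes. -/
lemma setIntegral_annulus_one_div_eq_zero (t δ R : ℝ) :
    ∫ s in {s : ℝ | δ < |t - s| ∧ |t - s| ≤ R}, 1 / (t - s) = 0 := by
  have hms : MeasurableSet {s : ℝ | δ < |t - s| ∧ |t - s| ≤ R} := by measurability
  rw [← integral_indicator hms]
  set f := Set.indicator {s : ℝ | δ < |t - s| ∧ |t - s| ≤ R} (fun s => 1 / (t - s)) with hf
  have h1 : ∀ s, f (2 * t - s) = - f s := by
    intro s
    have e : t - (2 * t - s) = -(t - s) := by ring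
    simp only [hf, Set.indicator, Set.mem_ofPred_eq, e, abs_neg]
    split_ifs
    · rw [div_neg]
    · simp
  have h2 := integral_sub_left_eq_self f volume (2 * t)
  simp only [h1, integral_neg] at h2
  linarith

/-- Decay of the Hilbert transform of a compactly supported Lipschitz function of mean zero. -/
lemma hilbert_decay {φ K : ℝ → ℝ} {M L : ℝ} (hL : 1 ≤ L) (hM : 0 ≤ M)
    (hlip : ∀ x y, |φ x - φ y| ≤ M * |x - y|) (hsupp : ∀ s, L ≤ |s| → φ s = 0)
    (hmean : ∫ s in Set.Icc (-L) L, φ s = 0)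
    (hK : ∀ t : ℝ, Tendsto (fun δ : ℝ => ∫ s in {s : ℝ | δ < |t - s|}, φ s / (t - s))
      (𝓝[>] (0:ℝ)) (𝓝 (Real.pi * K t))) :
    ∃ C, 0 ≤ C ∧ ∀ t, |K t| ≤ C / (1 + |t|) ^ 2 := by
  have hcont : Continuous φ := by
    refine (LipschitzWith.of_dist_le_mul (K := ⟨M, hM⟩) fun x y => ?_).continuous
    simp only [Real.dist_eq]; exact hlip x y
  have hsup : ∀ s, |φ s| ≤ M * (2 * L) := by
    intro s
    by_cases h : L ≤ |s|
    · rw [hsupp s h, abs_zero]; positivity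
    · push Not at h
      have h1 := hlip s L
      rw [hsupp L (le_abs_self L), sub_zero] at h1
      refine h1.trans (mul_le_mul_of_nonneg_left ?_ hM)
      rw [abs_lt] at h
      rw [abs_le]; constructor <;> linarith
  have key : ∀ t δ : ℝ, 0 < δ → δ < L →
      |∫ s in {s : ℝ | δ < |t - s|}, φ s / (t - s)| ≤
        (M * (64 * L ^ 3) + M * (36 * L ^ 3)) / (1 + |t|) ^ 2 := by
    intro t δ hδ hδL
    have hpos : 0 < (1 + |t|) ^ 2 := by positivity
    have hmsA : MeasurableSet {s : ℝ | δ < |t - s|} := by measurability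
    rw [le_div_iff₀ hpos]
    rcases le_or_gt (2 * L) |t| with ht | ht
    · have hst : ∀ s, |s| ≤ L → |t| / 2 ≤ |t - s| := fun s hs => by
        have := abs_sub_abs_le_abs_sub t s
        linarith
      have hne : ∀ s, |s| ≤ L → t - s ≠ 0 := fun s hs h => by
        have := hst s hs
        rw [h, abs_zero] at this; linarith
      have htne : t ≠ 0 := by
        rintro rfl
        rw [abs_zero] at ht; linarith
      have e1 : ∫ s in {s : ℝ | δ < |t - s|}, φ s / (t - s)
          = ∫ s in Set.Icc (-L) L, φ s / (t - s) := by
        refine setIntegral_eq_of_subset_of_forall_sdiff_eq_zero hmsA ?_ ?_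
        · intro s hs
          have := hst s (abs_le.2 hs)
          change δ < |t - s|; linarith
        · intro s hs
          have : L ≤ |s| := by
            by_contra! h
            exact hs.2 (abs_le.1 h.le)
          rw [hsupp s this, zero_div]
      have e2 : ∫ s in Set.Icc (-L) L, φ s / (t - s)
          = ∫ s in Set.Icc (-L) L, (φ s / (t - s) - φ s * t⁻¹) := by
        rw [integral_sub, integral_mul_const, hmean, zero_mul, sub_zero]
        · refine ContinuousOn.integrableOn_compact isCompact_Icc ?_
          exact hcont.continuousOn.div (by fun_prop) fun s hs => hne s (abs_le.2 hs)
        · exact (hcont.mul continuous_const).continuousOn.integrableOn_compact isCompact_Icc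
      rw [e1, e2]
      have h3 := norm_setIntegral_le_of_norm_le_const (μ := volume) (s := Set.Icc (-L) L)
        (f := fun s => φ s / (t - s) - φ s * t⁻¹) (C := M * (2 * L) * L * 2 / |t| ^ 2)
        (by simp) (by
          intro s hs
          have hs' : |s| ≤ L := abs_le.2 hs
          have : φ s / (t - s) - φ s * t⁻¹ = φ s * s / ((t - s) * t) := by
            have := hne s hs'
            field_simp; ring
          rw [this, Real.norm_eq_abs, abs_div, abs_mul, abs_mul]
          rw [div_le_div_iff₀ (by have := hne s hs'; positivity) (by positivity)]
          have a1 : |φ s| * |s| ≤ M * (2 * L) * L :=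
            mul_le_mul (hsup s) hs' (abs_nonneg _) (by positivity)
          have a2 := hst s hs'
          have a3 : |t| ^ 2 ≤ 2 * (|t - s| * |t|) := by nlinarith [abs_nonneg t]
          calc |φ s| * |s| * |t| ^ 2 ≤ M * (2 * L) * L * (2 * (|t - s| * |t|)) :=
                mul_le_mul a1 a3 (by positivity) (by positivity)
            _ = _ := by ring)
      rw [Real.norm_eq_abs] at h3
      have h4 : (volume : Measure ℝ).real (Set.Icc (-L) L) = 2 * L := by
        rw [Measure.real, Real.volume_Icc, ENNReal.toReal_ofReal (by linarith)]; ring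
      rw [h4] at h3
      have h5 : (1 + |t|) ^ 2 ≤ 4 * |t| ^ 2 := by nlinarith
      have htp : 0 < |t| := by linarith
      calc _ ≤ M * (2 * L) * L * 2 / |t| ^ 2 * (2 * L) * (4 * |t| ^ 2) :=
            mul_le_mul h3 h5 hpos.le (by positivity)
        _ = M * (32 * L ^ 3) := by field_simp; ring
        _ ≤ _ := by
          have : 0 ≤ M * L ^ 3 := by positivity
          linarith
    · have hmsB : MeasurableSet {s : ℝ | δ < |t - s| ∧ |t - s| ≤ 3 * L} := by measurability
      have hBfin : volume {s : ℝ | δ < |t - s| ∧ |t - s| ≤ 3 * L} ≤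
          ENNReal.ofReal (6 * L) := by
        refine (measure_mono (t := Set.Icc (t - 3 * L) (t + 3 * L)) fun s hs => ?_).trans ?_
        · have := abs_le.1 hs.2
          constructor <;> linarith
        · rw [Real.volume_Icc]
          refine ENNReal.ofReal_le_ofReal ?_
          linarith
      have hBlt := hBfin.trans_lt ENNReal.ofReal_lt_top
      have hbd : ∀ s, |(t - s)⁻¹| ≤ δ⁻¹ ∨ ¬ δ < |t - s| := fun s => by
        by_cases h : δ < |t - s|
        · left
          rw [abs_inv]
          exact inv_anti₀ hδ h.le
        · exact Or.inr h
      have e1 : ∫ s in {s : ℝ | δ < |t - s|}, φ s / (t - s)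
          = ∫ s in {s : ℝ | δ < |t - s| ∧ |t - s| ≤ 3 * L}, φ s / (t - s) := by
        refine setIntegral_eq_of_subset_of_forall_sdiff_eq_zero hmsA (fun s hs => hs.1) ?_
        intro s hs
        have h3 : 3 * L < |t - s| := by
          by_contra! h
          exact hs.2 ⟨hs.1, h⟩
        have : L ≤ |s| := by
          have := abs_sub t s
          linarith
        rw [hsupp s this, zero_div]
      have e2 : ∫ s in {s : ℝ | δ < |t - s| ∧ |t - s| ≤ 3 * L}, φ s / (t - s)
          = ∫ s in {s : ℝ | δ < |t - s| ∧ |t - s| ≤ 3 * L}, (φ s - φ t) / (t - s) := by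
        have i1 : IntegrableOn (fun s => 1 / (t - s))
            {s : ℝ | δ < |t - s| ∧ |t - s| ≤ 3 * L} := by
          refine Measure.integrableOn_of_bounded (M := δ⁻¹) hBlt.ne
            (Measurable.aestronglyMeasurable (by fun_prop)) ?_
          refine (ae_restrict_iff' hmsB).2 (ae_of_all _ fun s hs => ?_)
          rcases hbd s with h | h
          · simpa using h
          · exact absurd hs.1 h
        have i2 : IntegrableOn (fun s => φ s / (t - s))
            {s : ℝ | δ < |t - s| ∧ |t - s| ≤ 3 * L} := by
          refine Measure.integrableOn_of_bounded (M := M * (2 * L) * δ⁻¹) hBlt.ne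
            (Measurable.aestronglyMeasurable (by have := hcont.measurable; fun_prop)) ?_
          refine (ae_restrict_iff' hmsB).2 (ae_of_all _ fun s hs => ?_)
          rcases hbd s with h | h
          · rw [div_eq_mul_inv, norm_mul]
            exact mul_le_mul (hsup s) h (norm_nonneg _) (by positivity)
          · exact absurd hs.1 h
        have e3 : ∀ s, (φ s - φ t) / (t - s) = φ s / (t - s) - φ t * (1 / (t - s)) := by
          intro s; ring
        simp only [e3]
        rw [integral_sub i2 (i1.const_mul _), integral_const_mul,
          setIntegral_annulus_one_div_eq_zero, mul_zero, sub_zero]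
      rw [e1, e2]
      have h3 := norm_setIntegral_le_of_norm_le_const (μ := volume)
        (s := {s : ℝ | δ < |t - s| ∧ |t - s| ≤ 3 * L})
        (f := fun s => (φ s - φ t) / (t - s)) (C := M) hBlt (by
          intro s hs
          have : 0 < |t - s| := hδ.trans hs.1
          rw [Real.norm_eq_abs, abs_div, div_le_iff₀ this, abs_sub_comm t s]
          exact hlip s t)
      rw [Real.norm_eq_abs] at h3
      have h4 : (volume : Measure ℝ).real {s : ℝ | δ < |t - s| ∧ |t - s| ≤ 3 * L} ≤ 6 * L := by
        rw [Measure.real]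
        exact ENNReal.toReal_le_of_le_ofReal (by linarith) hBfin
      have h5 : (1 + |t|) ^ 2 ≤ 9 * L ^ 2 := by nlinarith [abs_nonneg t]
      calc _ ≤ M * (6 * L) * (9 * L ^ 2) :=
            mul_le_mul (h3.trans (mul_le_mul_of_nonneg_left h4 hM)) h5 hpos.le (by positivity)
        _ = M * (54 * L ^ 3) := by ring
        _ ≤ _ := by
          have : 0 ≤ M * L ^ 3 := by positivity
          linarith
  refine ⟨M * (64 * L ^ 3) + M * (36 * L ^ 3), by positivity, fun t => ?_⟩
  have h1 : |Real.pi * K t| ≤ (M * (64 * L ^ 3) + M * (36 * L ^ 3)) / (1 + |t|) ^ 2 := by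
    refine le_of_tendsto (hK t).abs ?_
    filter_upwards [Ioo_mem_nhdsGT (show (0:ℝ) < L by linarith)] with δ hδ
    exact key t δ hδ.1 hδ.2
  rw [abs_mul, abs_of_pos Real.pi_pos] at h1
  refine le_trans ?_ h1
  have := Real.pi_gt_three
  nlinarith [abs_nonneg (K t)]

/-- If the integer translates of `φ` cancel locally, then so do those of its Hilbert transform. -/
lemma tsum_hilbert_translates_eq_zero {φ K : ℝ → ℝ} {L : ℕ} (hcont : Continuous φ)
    (hsupp : ∀ s, (L : ℝ) ≤ |s| → φ s = 0)
    (hsum : ∀ (N : ℕ) (s : ℝ), |s| + L < N →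
      ∑ j ∈ Finset.Icc (-(N : ℤ)) N, φ (s - (j : ℝ)) = 0)
    (hK : ∀ t : ℝ, Tendsto (fun δ : ℝ => ∫ s in {s : ℝ | δ < |t - s|}, φ s / (t - s))
      (𝓝[>] (0:ℝ)) (𝓝 (Real.pi * K t))) (t : ℝ) (hs : Summable fun j : ℤ => K (t - (j : ℝ))) :
    ∑' j : ℤ, K (t - (j : ℝ)) = 0 := by
  have hint : Integrable φ := by
    refine hcont.integrable_of_hasCompactSupport ?_
    refine HasCompactSupport.intro (isCompact_Icc (a := -(L : ℝ)) (b := L)) fun x hx => ?_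
    refine hsupp x ?_
    by_contra! h
    exact hx (abs_le.1 h.le)
  have hintj : ∀ j : ℤ, Integrable fun s => |φ (s - (j : ℝ))| := fun j =>
    (hint.comp_sub_right (j : ℝ)).abs
  set A : ℝ := ∫ s, |φ s| with hA
  have hbound : ∀ N : ℕ, |t| + L < N →
      |∑ j ∈ Finset.Icc (-(N : ℤ)) N, K (t - (j : ℝ))| ≤
        ((4 * L + 2 : ℕ) * A / Real.pi) / (N - (L + |t|)) := by
    intro N hN
    have hR : 0 < (N : ℝ) - (L + |t|) := by linarith
    set J := (Finset.Icc (-(N : ℤ)) N).filter (fun j => (N : ℤ) - 2 * L ≤ |j|) with hJ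
    have hcard : J.card ≤ 4 * L + 2 := by
      have hsub : J ⊆ Finset.Icc (-(N : ℤ)) (-N + 2 * L) ∪ Finset.Icc ((N : ℤ) - 2 * L) N := by
        intro j hj
        simp only [hJ, Finset.mem_filter, Finset.mem_Icc, Finset.mem_union] at hj ⊢
        rcases le_abs.1 hj.2 with h | h
        · right; omega
        · left; omega
      refine (Finset.card_le_card hsub).trans ((Finset.card_union_le _ _).trans ?_)
      rw [Int.card_Icc, Int.card_Icc]
      omega
    have hJsum : ∀ s : ℝ, (N : ℝ) - L ≤ |s| →
        ∑ j ∈ Finset.Icc (-(N : ℤ)) N, φ (s - (j : ℝ)) = ∑ j ∈ J, φ (s - (j : ℝ)) := by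
      intro s hsN
      symm
      refine Finset.sum_filter_of_ne fun j hj hne => ?_
      by_contra! hlt
      refine hne (hsupp _ ?_)
      have h1 : (|j| : ℝ) < N - 2 * L := by exact_mod_cast hlt
      have h2 := abs_sub_abs_le_abs_sub s (j : ℝ)
      linarith
    have hlim : Tendsto (fun δ : ℝ => ∫ s in {s : ℝ | δ < |t - s|},
        (∑ j ∈ Finset.Icc (-(N : ℤ)) N, φ (s - (j : ℝ))) / (t - s)) (𝓝[>] (0:ℝ))
        (𝓝 (∑ j ∈ Finset.Icc (-(N : ℤ)) N, Real.pi * K (t - (j : ℝ)))) := by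
      refine Tendsto.congr' ?_
        (tendsto_finsetSum (Finset.Icc (-(N : ℤ)) N) fun j _ => hK (t - (j : ℝ)))
      filter_upwards [self_mem_nhdsWithin] with δ hδ
      have hδ0 : (0 : ℝ) < δ := hδ
      have hms : MeasurableSet {s : ℝ | δ < |t - s|} := by measurability
      simp only [Finset.sum_div]
      rw [integral_finsetSum]
      · refine Finset.sum_congr rfl fun j _ => ?_
        have hms' : MeasurableSet {s : ℝ | δ < |t - (j : ℝ) - s|} := by measurability
        rw [← integral_indicator hms, ← integral_indicator hms',
          ← integral_sub_right_eq_self _ (j : ℝ)]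
        congr 1
        ext s
        have e : t - (j : ℝ) - (s - j) = t - s := by ring
        simp only [Set.indicator, Set.mem_ofPred_eq, e]
      · intro j _
        refine Integrable.mono' (((hintj j).mul_const δ⁻¹).integrableOn)
          (Measurable.aestronglyMeasurable (by have := hcont.measurable; fun_prop)) ?_
        refine (ae_restrict_iff' hms).2 (ae_of_all _ fun s hs => ?_)
        rw [div_eq_mul_inv, norm_mul, Real.norm_eq_abs, Real.norm_eq_abs, abs_inv]
        exact mul_le_mul_of_nonneg_left (inv_anti₀ hδ0 (le_of_lt hs)) (abs_nonneg _)
    rw [← Finset.mul_sum] at hlim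
    have hle : ∀ δ : ℝ, |∫ s in {s : ℝ | δ < |t - s|},
        (∑ j ∈ Finset.Icc (-(N : ℤ)) N, φ (s - (j : ℝ))) / (t - s)| ≤
          (4 * L + 2 : ℕ) * A / (N - (L + |t|)) := by
      intro δ
      have hgi : Integrable fun s => (∑ j ∈ J, |φ (s - (j : ℝ))|) / ((N : ℝ) - (L + |t|)) :=
        (integrable_finsetSum _ fun j _ => hintj j).div_const _
      have hg0 : ∀ s, 0 ≤ (∑ j ∈ J, |φ (s - (j : ℝ))|) / ((N : ℝ) - (L + |t|)) := fun s =>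
        div_nonneg (Finset.sum_nonneg fun j _ => abs_nonneg _) hR.le
      rw [← Real.norm_eq_abs]
      refine (norm_integral_le_of_norm_le (μ := volume.restrict {s : ℝ | δ < |t - s|})
        hgi.integrableOn (ae_of_all _ fun s => ?_)).trans ?_
      · rcases lt_or_ge |s| (N - L) with h | h
        · rw [hsum N s (by linarith), zero_div, norm_zero]
          exact hg0 s
        · have h1 := abs_sub_abs_le_abs_sub s t
          rw [abs_sub_comm] at h1
          rw [hJsum s h, Real.norm_eq_abs, abs_div]
          exact div_le_div₀ (Finset.sum_nonneg fun j _ => abs_nonneg _)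
            (Finset.abs_sum_le_sum_abs _ _) hR (by linarith)
      · refine (setIntegral_le_integral hgi (ae_of_all _ hg0)).trans ?_
        rw [integral_div, integral_finsetSum _ fun j _ => hintj j]
        have : ∀ j : ℤ, ∫ s, |φ (s - (j : ℝ))| = A := fun j =>
          integral_sub_right_eq_self (fun s => |φ s|) (j : ℝ)
        simp only [this, Finset.sum_const, nsmul_eq_mul]
        have hA0 : 0 ≤ A := integral_nonneg fun s => abs_nonneg _
        gcongr
    have h1 := le_of_tendsto hlim.abs (Eventually.of_forall hle)
    rw [abs_mul, abs_of_pos Real.pi_pos] at h1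
    rw [div_right_comm, le_div_iff₀ Real.pi_pos, mul_comm]
    exact h1
  have ht1 : Tendsto (fun N : ℕ => ∑ j ∈ Finset.Icc (-(N : ℤ)) N, K (t - (j : ℝ))) atTop
      (𝓝 (∑' j : ℤ, K (t - (j : ℝ)))) := by
    have := hs.hasSum.comp (Finset.tendsto_Icc_neg (R := ℤ))
    exact this
  have ht2 : Tendsto (fun N : ℕ => ∑ j ∈ Finset.Icc (-(N : ℤ)) N, K (t - (j : ℝ))) atTop
      (𝓝 0) := by
    refine squeeze_zero_norm' (a := fun N : ℕ =>
      ((4 * L + 2 : ℕ) * A / Real.pi) / ((N : ℝ) - (L + |t|))) ?_ ?_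
    · filter_upwards [tendsto_natCast_atTop_atTop.eventually_gt_atTop (|t| + L)] with N hN
      exact hbound N hN
    · refine Tendsto.const_div_atTop ?_ _
      exact tendsto_atTop_add_const_right _ _ tendsto_natCast_atTop_atTop
  exact tendsto_nhds_unique ht1 ht2

/-- Differentiating a locally finite partition of unity by integer translates. -/
lemma sum_deriv_translates_eq_zero {f : ℝ → ℝ} {L : ℕ} (hd : ∀ x, DifferentiableAt ℝ f x)
    (hsupp : ∀ s, (L : ℝ) ≤ |s| → f s = 0)
    (hsum : ∀ u : ℝ, ∑' j : ℤ, f (u - (j : ℝ)) = 1) (N : ℕ) (s : ℝ) (hs : |s| + L < N) :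
    ∑ j ∈ Finset.Icc (-(N : ℤ)) N, deriv f (s - (j : ℝ)) = 0 := by
  have h1 : HasDerivAt (fun u => ∑ j ∈ Finset.Icc (-(N : ℤ)) N, f (u - (j : ℝ)))
      (∑ j ∈ Finset.Icc (-(N : ℤ)) N, deriv f (s - (j : ℝ))) s :=
    HasDerivAt.fun_sum fun j _ => (hd _).hasDerivAt.comp_sub_const _ _
  have h2 : (fun u => ∑ j ∈ Finset.Icc (-(N : ℤ)) N, f (u - (j : ℝ))) =ᶠ[𝓝 s] fun _ => 1 := by
    have hu : ∀ᶠ u : ℝ in 𝓝 s, |u| + (L : ℝ) < (N : ℝ) :=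
      (continuous_abs.add continuous_const).continuousAt.eventually_lt_const hs
    filter_upwards [hu] with u hu
    rw [← hsum u]
    symm
    refine tsum_eq_sum fun j hj => hsupp _ ?_
    have hj' : (N : ℤ) < |j| := by
      by_contra! h
      exact hj (Finset.mem_Icc.2 (abs_le.1 h))
    have h3 : (N : ℝ) < |(j : ℝ)| := by exact_mod_cast hj'
    have h4 := abs_sub_abs_le_abs_sub (j : ℝ) u
    rw [abs_sub_comm] at h4
    linarith
  exact h1.unique ((hasDerivAt_const s (1 : ℝ)).congr_of_eventuallyEq h2)

/-- Continuous profiles `B y ν`, bounded by `A`, supported in `|y| ≤ b`, and `δ`-Hölder in `ν`. -/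
structure IsHolderProfile (b A δ : ℝ) (B : ℝ → ℝ → ℝ) : Prop where
  cont : Continuous fun z : ℝ × ℝ => B z.1 z.2
  bound : ∀ y ν, |B y ν| ≤ A
  supp : ∀ y ν, b < |y| → B y ν = 0
  holder : ∀ y ν ν', |B y ν - B y ν'| ≤ A * |ν - ν'| ^ δ

lemma IsHolderProfile.comp_neg {b A δ : ℝ} {B : ℝ → ℝ → ℝ} (hB : IsHolderProfile b A δ B) :
    IsHolderProfile b A δ fun y ν => B y (-ν) where
  cont := hB.cont.comp (continuous_fst.prodMk continuous_snd.neg)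
  bound y ν := hB.bound y (-ν)
  supp y ν h := hB.supp y (-ν) h
  holder y ν ν' := by
    refine (hB.holder y (-ν) (-ν')).trans_eq ?_
    rw [neg_sub_neg, abs_sub_comm]

/-- Change of variables `y = x - l ν²` in the integral of a profile along a half parabola. -/
lemma IsHolderProfile.integral_Ioi_eq {b A δ l x : ℝ} {B : ℝ → ℝ → ℝ}
    (hB : IsHolderProfile b A δ B) (hl : 0 < l) (hx : b < x) :
    ∫ ν in Set.Ioi (0 : ℝ), B (x - l * ν ^ 2) ν =
      ∫ y in Set.Icc (-b) b, (2 * l * √((x - y) / l))⁻¹ * B y (√((x - y) / l)) := by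
  have himg : (fun y => √((x - y) / l)) '' Set.Iio x = Set.Ioi 0 := by
    ext ν
    constructor
    · rintro ⟨y, hy, rfl⟩
      exact Real.sqrt_pos.2 (div_pos (sub_pos.2 hy) hl)
    · intro hν
      have hν0 : 0 < ν := hν
      refine ⟨x - l * ν ^ 2, ?_, ?_⟩
      · have : 0 < l * ν ^ 2 := by positivity
        simpa using this
      · have : (x - (x - l * ν ^ 2)) / l = ν ^ 2 := by field_simp; ring
        simp only [this]
        exact Real.sqrt_sq hν0.le
  have hsq : ∀ y ∈ Set.Iio x, √((x - y) / l) ^ 2 = (x - y) / l := fun y hy =>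
    Real.sq_sqrt (div_pos (sub_pos.2 hy) hl).le
  have hder : ∀ y ∈ Set.Iio x, HasDerivWithinAt (fun y => √((x - y) / l))
      (-(2 * l * √((x - y) / l))⁻¹) (Set.Iio x) y := by
    intro y hy
    have h0 : 0 < (x - y) / l := div_pos (sub_pos.2 hy) hl
    have h1 : HasDerivAt (fun y => (x - y) / l) (-1 / l) y :=
      ((hasDerivAt_id y).const_sub x).div_const l
    have h2 := (h1.sqrt h0.ne').hasDerivWithinAt (s := Set.Iio x)
    have h3 := (Real.sqrt_pos.2 h0).ne'
    have e : -(2 * l * √((x - y) / l))⁻¹ = -1 / l / (2 * √((x - y) / l)) := by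
      field_simp
    rw [e]
    exact h2
  have hinj : Set.InjOn (fun y => √((x - y) / l)) (Set.Iio x) := by
    intro y hy y' hy' h
    have h1 : √((x - y) / l) = √((x - y') / l) := h
    have h2 := hsq y hy
    rw [h1, hsq y' hy'] at h2
    field_simp at h2
    linarith
  rw [← himg, integral_image_eq_integral_abs_deriv_smul measurableSet_Iio hder hinj]
  have e : ∀ y ∈ Set.Iio x, |(-(2 * l * √((x - y) / l))⁻¹)| •
      B (x - l * √((x - y) / l) ^ 2) (√((x - y) / l)) =
      (2 * l * √((x - y) / l))⁻¹ * B y (√((x - y) / l)) := by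
    intro y hy
    have h0 : 0 ≤ (2 * l * √((x - y) / l))⁻¹ := by positivity
    rw [hsq y hy, abs_neg, abs_of_nonneg h0, smul_eq_mul]
    congr 2
    field_simp
    ring
  rw [setIntegral_congr_fun measurableSet_Iio e]
  refine setIntegral_eq_of_subset_of_forall_sdiff_eq_zero measurableSet_Iio ?_ ?_
  · intro y hy
    exact lt_of_le_of_lt hy.2 hx
  · intro y hy
    rw [hB.supp, mul_zero]
    by_contra! h
    exact hy.2 (abs_le.1 h)

/-- Size and regularity of the integral of a profile along a half parabola. -/
lemma IsHolderProfile.exists_bound_Ioi {b A δ l : ℝ} (hb : 1 ≤ b) (hA : 0 ≤ A) (hδ : 0 < δ)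
    (hδ1 : δ ≤ 1) (hl : 0 < l) :
    ∃ C, 0 ≤ C ∧ ∀ B, IsHolderProfile b A δ B →
      (∀ x < -b, ∫ ν in Set.Ioi (0 : ℝ), B (x - l * ν ^ 2) ν = 0) ∧
      (∀ x ≥ -b, |∫ ν in Set.Ioi (0 : ℝ), B (x - l * ν ^ 2) ν| ≤ C / √(x + b + 2)) ∧
      (∀ p ≥ 4 * b, ∀ x, |(∫ ν in Set.Ioi (0 : ℝ), B (x - l * ν ^ 2) ν) -
        ∫ ν in Set.Ioi (0 : ℝ), B (p - l * ν ^ 2) ν| ≤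
          C * ((1 + |x - p|) / p) ^ ((1 + δ) / 2)) := by
  set m := √l with hm
  have hm0 : 0 < m := Real.sqrt_pos.2 hl
  have hmm : m ^ 2 = l := Real.sq_sqrt hl.le
  have hvol : (volume : Measure ℝ).real (Set.Icc (-b) b) = 2 * b := by
    rw [Measure.real, Real.volume_Icc, ENNReal.toReal_ofReal (by linarith)]; ring
  have hzlow : ∀ u c : ℝ, 0 < c → c / 9 ≤ u → √c / (3 * m) ≤ √(u / l) := by
    intro u c hc hu
    rw [Real.sqrt_div' _ hl.le, div_le_div_iff₀ (by positivity) hm0]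
    have : √c ≤ 3 * √u := by
      rw [Real.sqrt_le_left (by positivity), mul_pow, Real.sq_sqrt (by linarith)]
      linarith
    nlinarith
  have hκ : ∀ u c : ℝ, 0 < c → c / 9 ≤ u → (2 * l * √(u / l))⁻¹ ≤ 3 / m / √c := by
    intro u c hc hu
    have h1 := hzlow u c hc hu
    have h2 : 0 < √c := Real.sqrt_pos.2 hc
    have h3 : m * √c / 3 ≤ 2 * l * √(u / l) := by
      have h4 : l * (√c / (3 * m)) = m * √c / 3 := by rw [← hmm]; field_simp
      have h5 := mul_le_mul_of_nonneg_left h1 hl.le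
      have h6 : 0 ≤ l * √(u / l) := by positivity
      linarith
    refine (inv_anti₀ (by positivity) h3).trans_eq ?_
    field_simp
  set C1 := A * √(3 * b / l) * √(4 * b + 2) with hC1
  set C2 := 2 * b * (A * (3 / m)) with hC2
  set C3 := A * (3 / m * (3 / m) ^ δ) + A * (54 / m) with hC3
  have h1 : 0 ≤ C1 := by positivity
  have h2 : 0 ≤ C2 := by positivity
  have h3 : 0 ≤ C3 := by positivity
  refine ⟨4 * (C1 + C2) + 2 * b * C3, by positivity, fun B hB => ?_⟩
  have hzero : ∀ x < -b, ∫ ν in Set.Ioi (0 : ℝ), B (x - l * ν ^ 2) ν = 0 := by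
    intro x hx
    refine setIntegral_eq_zero_of_forall_eq_zero fun ν _ => hB.supp _ _ ?_
    have : 0 ≤ l * ν ^ 2 := by positivity
    refine lt_of_lt_of_le ?_ (neg_le_abs _)
    linarith
  have hsize : ∀ x ≥ -b, |∫ ν in Set.Ioi (0 : ℝ), B (x - l * ν ^ 2) ν| ≤
      (C1 + C2) / √(x + b + 2) := by
    intro x hx
    have hc : 0 < x + b + 2 := by linarith
    have hsc : 0 < √(x + b + 2) := Real.sqrt_pos.2 hc
    rcases le_or_gt x (2 * b) with hx2 | hx2
    · have e : ∫ ν in Set.Ioi (0 : ℝ), B (x - l * ν ^ 2) ν =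
          ∫ ν in Set.Ioc (0 : ℝ) (√(3 * b / l)), B (x - l * ν ^ 2) ν := by
        refine setIntegral_eq_of_subset_of_forall_sdiff_eq_zero measurableSet_Ioi
          Set.Ioc_subset_Ioi_self fun ν hν => hB.supp _ _ ?_
        have hν0 : 0 < ν := hν.1
        have h4 : √(3 * b / l) < ν := by
          by_contra! h
          exact hν.2 ⟨hν0, h⟩
        rw [Real.sqrt_lt' hν0, div_lt_iff₀ hl] at h4
        refine lt_of_lt_of_le ?_ (neg_le_abs _)
        linarith
      have h5 := norm_setIntegral_le_of_norm_le_const (μ := volume)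
        (s := Set.Ioc (0 : ℝ) (√(3 * b / l))) (f := fun ν => B (x - l * ν ^ 2) ν) (C := A)
        (by simp) fun ν _ => hB.bound _ _
      rw [Measure.real, Real.volume_Ioc, sub_zero, ENNReal.toReal_ofReal (Real.sqrt_nonneg _),
        Real.norm_eq_abs] at h5
      rw [e, le_div_iff₀ hsc]
      calc _ ≤ A * √(3 * b / l) * √(4 * b + 2) := by
            refine mul_le_mul h5 (Real.sqrt_le_sqrt (by linarith)) hsc.le (by positivity)
        _ ≤ C1 + C2 := by linarith
    · rw [hB.integral_Ioi_eq hl (by linarith)]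
      have h5 := norm_setIntegral_le_of_norm_le_const (μ := volume)
        (s := Set.Icc (-b) b) (f := fun y => (2 * l * √((x - y) / l))⁻¹ * B y (√((x - y) / l)))
        (C := 3 / m / √(x + b + 2) * A) (by simp) (by
          intro y hy
          rw [norm_mul]
          refine mul_le_mul ?_ (hB.bound _ _) (norm_nonneg _) (by positivity)
          rw [Real.norm_eq_abs, abs_of_nonneg (by positivity)]
          exact hκ _ _ hc (by linarith [hy.2]))
      rw [hvol, Real.norm_eq_abs] at h5
      refine h5.trans ?_
      rw [le_div_iff₀ hsc]
      have : 3 / m / √(x + b + 2) * A * (2 * b) * √(x + b + 2) = C2 := by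
        rw [hC2]; field_simp
      linarith
  have hbdd : ∀ x, |∫ ν in Set.Ioi (0 : ℝ), B (x - l * ν ^ 2) ν| ≤ C1 + C2 := by
    intro x
    rcases lt_or_ge x (-b) with hx | hx
    · rw [hzero x hx, abs_zero]; positivity
    · refine (hsize x hx).trans (div_le_self (by positivity) ?_)
      rw [Real.one_le_sqrt]
      linarith
  refine ⟨hzero, fun x hx => (hsize x hx).trans ?_, fun p hp x => ?_⟩
  · have : 0 ≤ 2 * b * C3 := by positivity
    exact div_le_div_of_nonneg_right (by linarith) (Real.sqrt_nonneg _)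
  have hp0 : 0 < p := by linarith
  have hd0 : 0 ≤ |x - p| := abs_nonneg _
  set d := |x - p| with hd
  have hr0 : 0 ≤ (1 + d) / p := by positivity
  rcases le_or_gt (p / 2) d with hdp | hdp
  · have h4 : (1 / 2 : ℝ) ≤ ((1 + d) / p) ^ ((1 + δ) / 2) := by
      have h5 : (1 / 2 : ℝ) ≤ (1 + d) / p := by
        rw [le_div_iff₀ hp0]; linarith
      calc (1 / 2 : ℝ) = (1 / 2) ^ (1 : ℝ) := by rw [Real.rpow_one]
        _ ≤ (1 / 2) ^ ((1 + δ) / 2) :=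
          Real.rpow_le_rpow_of_exponent_ge (by norm_num) (by norm_num) (by linarith)
        _ ≤ _ := Real.rpow_le_rpow (by norm_num) h5 (by linarith)
    have h5 := abs_sub (∫ ν in Set.Ioi (0 : ℝ), B (x - l * ν ^ 2) ν)
      (∫ ν in Set.Ioi (0 : ℝ), B (p - l * ν ^ 2) ν)
    have h6 := hbdd x
    have h7 := hbdd p
    calc _ ≤ (4 * (C1 + C2)) * (1 / 2) := by linarith
      _ ≤ _ := by
        refine mul_le_mul ?_ h4 (by norm_num) (by positivity)
        have : 0 ≤ 2 * b * C3 := by positivity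
        linarith
  · have hxp := abs_lt.1 (hd ▸ hdp)
    have hsp : 0 < √p := Real.sqrt_pos.2 hp0
    have hcont : ∀ x', b < x' → IntegrableOn
        (fun y => (2 * l * √((x' - y) / l))⁻¹ * B y (√((x' - y) / l))) (Set.Icc (-b) b) := by
      intro x' hx'
      refine ContinuousOn.integrableOn_compact isCompact_Icc (ContinuousOn.mul ?_ ?_)
      · refine ContinuousOn.inv₀ (by fun_prop) fun y hy => ?_
        have : 0 < (x' - y) / l := div_pos (by linarith [hy.2]) hl
        have := Real.sqrt_pos.2 this
        positivity
      · have := hB.cont.comp (f := fun y : ℝ => (y, √((x' - y) / l))) (by fun_prop)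
        exact this.continuousOn
    rw [hB.integral_Ioi_eq hl (by linarith), hB.integral_Ioi_eq hl (by linarith),
      ← integral_sub (hcont x (by linarith)) (hcont p (by linarith))]
    have h5 := norm_setIntegral_le_of_norm_le_const (μ := volume)
        (s := Set.Icc (-b) b) (f := fun y => (2 * l * √((x - y) / l))⁻¹ * B y (√((x - y) / l)) -
          (2 * l * √((p - y) / l))⁻¹ * B y (√((p - y) / l)))
        (C := C3 * ((1 + d) / p) ^ ((1 + δ) / 2)) (by simp) (by
          intro y hy
          have hu9 : p / 9 ≤ x - y := by linarith [hy.2]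
          have hv9 : p / 9 ≤ p - y := by linarith [hy.2]
          have ku := hκ _ p hp0 hu9
          have kv := hκ _ p hp0 hv9
          have zu := hzlow _ p hp0 hu9
          have zv := hzlow _ p hp0 hv9
          have su : √((x - y) / l) ^ 2 = (x - y) / l :=
            Real.sq_sqrt (div_pos (by linarith) hl).le
          have sv : √((p - y) / l) ^ 2 = (p - y) / l :=
            Real.sq_sqrt (div_pos (by linarith) hl).le
          set z := √((x - y) / l) with hz
          set z' := √((p - y) / l) with hz'
          have hρ : 0 < √p / (3 * m) := by positivity
          have hz0 : 0 < z := hρ.trans_le zu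
          have hz'0 : 0 < z' := hρ.trans_le zv
          have hzz : |z - z'| ≤ 3 / m * (d / √p) := by
            have e1 : |z - z'| * (z + z') = d / l := by
              rw [← abs_of_pos (add_pos hz0 hz'0), ← abs_mul]
              have : (z - z') * (z + z') = (x - p) / l := by
                have : (z - z') * (z + z') = z ^ 2 - z' ^ 2 := by ring
                rw [this, su, sv]; ring
              rw [this, abs_div, abs_of_pos hl]
            have e2 : |z - z'| * (√p / (3 * m)) ≤ d / l := by
              rw [← e1]
              exact mul_le_mul_of_nonneg_left (by linarith) (abs_nonneg _)
            have e3 : 3 / m * (d / √p) = d / l / (√p / (3 * m)) := by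
              rw [← hmm]; field_simp
            rw [e3, le_div_iff₀ hρ]
            exact e2
          have hsplit : (2 * l * z)⁻¹ * B y z - (2 * l * z')⁻¹ * B y z' =
              (2 * l * z)⁻¹ * (B y z - B y z') +
                (2 * l * z)⁻¹ * (2 * l * z')⁻¹ * (2 * l) * (z' - z) * B y z' := by
            field_simp; ring
          have hk0 : 0 ≤ (2 * l * z)⁻¹ := by positivity
          have hk'0 : 0 ≤ (2 * l * z')⁻¹ := by positivity
          have hsps : (√p)⁻¹ = p ^ (-(1 / 2 : ℝ)) := by
            rw [Real.sqrt_eq_rpow, Real.rpow_neg hp0.le]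
          have t1 : |(2 * l * z)⁻¹ * (B y z - B y z')| ≤
              A * (3 / m * (3 / m) ^ δ) * ((1 + d) / p) ^ ((1 + δ) / 2) := by
            rw [abs_mul, abs_of_nonneg hk0]
            calc (2 * l * z)⁻¹ * |B y z - B y z'|
                ≤ 3 / m / √p * (A * (3 / m * (d / √p)) ^ δ) := by
                  refine mul_le_mul ku ((hB.holder y z z').trans ?_) (abs_nonneg _)
                    (by positivity)
                  exact mul_le_mul_of_nonneg_left
                    (Real.rpow_le_rpow (abs_nonneg _) hzz hδ.le) hA
              _ = A * (3 / m * (3 / m) ^ δ) * (d ^ δ * p ^ (-((1 + δ) / 2))) := by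
                  rw [Real.mul_rpow (by positivity) (by positivity), div_eq_mul_inv d,
                    Real.mul_rpow hd0 (by positivity), div_eq_mul_inv _ (√p), hsps,
                    ← Real.rpow_mul hp0.le]
                  have : -((1 + δ) / 2) = -(1 / 2) + -(1 / 2) * δ := by ring
                  rw [this, Real.rpow_add hp0]
                  ring
              _ ≤ _ := by
                  rw [Real.div_rpow (by linarith) hp0.le, Real.rpow_neg hp0.le,
                    ← div_eq_mul_inv]
                  have h8 : d ^ δ ≤ (1 + d) ^ ((1 + δ) / 2) :=
                    (Real.rpow_le_rpow hd0 (by linarith) hδ.le).trans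
                      (Real.rpow_le_rpow_of_exponent_le (by linarith) (by linarith))
                  gcongr
          have t2 : |(2 * l * z)⁻¹ * (2 * l * z')⁻¹ * (2 * l) * (z' - z) * B y z'| ≤
              A * (54 / m) * ((1 + d) / p) ^ ((1 + δ) / 2) := by
            rw [abs_mul, abs_mul, abs_mul, abs_mul, abs_of_nonneg hk0, abs_of_nonneg hk'0,
              abs_of_pos (show 0 < 2 * l by linarith), abs_sub_comm z' z]
            calc (2 * l * z)⁻¹ * (2 * l * z')⁻¹ * (2 * l) * |z - z'| * |B y z'|
                ≤ 3 / m / √p * (3 / m / √p) * (2 * l) * (3 / m * (d / √p)) * A := by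
                  have := hB.bound y z'
                  gcongr
              _ = A * (54 / m) * (d / p) * (√p)⁻¹ := by
                  have hpp : p = √p ^ 2 := (Real.sq_sqrt hp0.le).symm
                  rw [← hmm]
                  nth_rewrite 4 [hpp]
                  field_simp
                  ring
              _ ≤ A * (54 / m) * (d / p) * 1 := by
                  refine mul_le_mul_of_nonneg_left (inv_le_one_of_one_le₀ ?_) (by positivity)
                  rw [Real.one_le_sqrt]; linarith
              _ ≤ _ := by
                  rw [mul_one]
                  refine mul_le_mul_of_nonneg_left ?_ (by positivity)
                  have h8 : d / p ≤ 1 := by rw [div_le_one hp0]; linarith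
                  calc d / p = (d / p) ^ (1 : ℝ) := by rw [Real.rpow_one]
                    _ ≤ (d / p) ^ ((1 + δ) / 2) := by
                      rcases eq_or_lt_of_le hd0 with h0 | h0
                      · rw [← h0, zero_div, Real.zero_rpow one_ne_zero,
                          Real.zero_rpow (by linarith)]
                      · exact Real.rpow_le_rpow_of_exponent_ge (by positivity) h8 (by linarith)
                    _ ≤ _ := Real.rpow_le_rpow (by positivity)
                      (div_le_div_of_nonneg_right (by linarith) hp0.le) (by linarith)
          rw [hsplit, Real.norm_eq_abs, hC3, add_mul]
          exact (abs_add_le _ _).trans (add_le_add t1 t2))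
    rw [hvol, Real.norm_eq_abs] at h5
    refine h5.trans ?_
    have : 0 ≤ (4 * (C1 + C2)) * ((1 + d) / p) ^ ((1 + δ) / 2) := by positivity
    linarith

/-- Size and regularity of the integral of a profile along a full parabola. -/
lemma IsHolderProfile.exists_bound {b A δ l : ℝ} (hb : 1 ≤ b) (hA : 0 ≤ A) (hδ : 0 < δ)
    (hδ1 : δ ≤ 1) (hl : 0 < l) :
    ∃ C, 0 ≤ C ∧ ∀ B, IsHolderProfile b A δ B →
      (∀ x < -b, ∫ ν : ℝ, B (x - l * ν ^ 2) ν = 0) ∧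
      (∀ x ≥ -b, |∫ ν : ℝ, B (x - l * ν ^ 2) ν| ≤ C / √(x + b + 2)) ∧
      (∀ p ≥ 4 * b, ∀ x, |(∫ ν : ℝ, B (x - l * ν ^ 2) ν) - ∫ ν : ℝ, B (p - l * ν ^ 2) ν| ≤
          C * ((1 + |x - p|) / p) ^ ((1 + δ) / 2)) := by
  obtain ⟨C, hC, h⟩ := IsHolderProfile.exists_bound_Ioi hb hA hδ hδ1 hl
  refine ⟨2 * C, by positivity, fun B hB => ?_⟩
  obtain ⟨z1, s1, d1⟩ := h B hB
  obtain ⟨z2, s2, d2⟩ := h _ hB.comp_neg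
  have e : ∀ x, ∫ ν : ℝ, B (x - l * ν ^ 2) ν = (∫ ν in Set.Ioi (0 : ℝ), B (x - l * ν ^ 2) ν) +
      ∫ ν in Set.Ioi (0 : ℝ), B (x - l * ν ^ 2) (-ν) := by
    intro x
    have hint : Integrable fun ν => B (x - l * ν ^ 2) ν := by
      have hc : Continuous fun ν => B (x - l * ν ^ 2) ν :=
        hB.cont.comp (f := fun ν : ℝ => (x - l * ν ^ 2, ν)) (by fun_prop)
      refine hc.integrable_of_hasCompactSupport ?_
      refine HasCompactSupport.intro
        (isCompact_Icc (a := -√((|x| + b) / l)) (b := √((|x| + b) / l))) fun ν hν => ?_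
      refine hB.supp _ _ ?_
      have h1 : √((|x| + b) / l) < |ν| := by
        by_contra! h
        exact hν (abs_le.1 h)
      have h2 : 0 ≤ |x| := abs_nonneg x
      have h3 : 0 < |ν| := (Real.sqrt_nonneg _).trans_lt h1
      rw [Real.sqrt_lt' h3, sq_abs, div_lt_iff₀ hl] at h1
      refine lt_of_lt_of_le ?_ (neg_le_abs _)
      linarith [le_abs_self x]
    rw [← intervalIntegral.integral_Iic_add_Ioi (b := 0) hint.integrableOn hint.integrableOn,
      add_comm]
    congr 1
    have := integral_comp_neg_Ioi (0 : ℝ) fun ν => B (x - l * ν ^ 2) ν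
    simpa using this.symm
  refine ⟨fun x hx => ?_, fun x hx => ?_, fun p hp x => ?_⟩
  · rw [e, z1 x hx, z2 x hx, add_zero]
  · rw [e, two_mul, add_div]
    exact (abs_add_le _ _).trans (add_le_add (s1 x hx) (s2 x hx))
  · rw [e, e, add_sub_add_comm, two_mul, add_mul]
    exact (abs_add_le _ _).trans (add_le_add (d1 p hp x) (d2 p hp x))

/-- A bounded `γ`-Hölder function is `δ`-Hölder for every `δ ≤ γ`. -/
lemma abs_sub_le_rpow_of_le {h : ℝ → ℝ} {c γ δ : ℝ} (hc : 0 ≤ c) (hδ : 0 ≤ δ) (hδγ : δ ≤ γ)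
    (hbd : ∀ x, |h x| ≤ c) (hh : ∀ x y, |h x - h y| ≤ c * |x - y| ^ γ) (x y : ℝ) :
    |h x - h y| ≤ 2 * c * |x - y| ^ δ := by
  rcases eq_or_ne x y with rfl | hxy
  · rw [sub_self, abs_zero]; positivity
  rcases le_or_gt 1 |x - y| with h1 | h1
  · have h2 := abs_sub (h x) (h y)
    have h3 := Real.one_le_rpow h1 hδ
    have h4 := hbd x
    have h5 := hbd y
    nlinarith
  · refine (hh x y).trans ?_
    have h0 : 0 ≤ |x - y| ^ δ := by positivity
    have h3 : |x - y| ^ γ ≤ |x - y| ^ δ :=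
      Real.rpow_le_rpow_of_exponent_ge (abs_pos.2 (sub_ne_zero.2 hxy)) h1.le hδγ
    nlinarith

lemma continuous_of_abs_sub_le_rpow {h : ℝ → ℝ} {c γ : ℝ} (hγ : 0 < γ)
    (hh : ∀ x y, |h x - h y| ≤ c * |x - y| ^ γ) : Continuous h := by
  refine continuous_iff_continuousAt.2 fun y => ?_
  rw [ContinuousAt, tendsto_iff_norm_sub_tendsto_zero]
  refine squeeze_zero (fun x => norm_nonneg _) (fun x => hh x y) ?_
  have : Continuous fun x => c * |x - y| ^ γ :=
    continuous_const.mul ((continuous_abs.comp (continuous_sub_right y)).rpow_const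
      fun _ => Or.inr hγ.le)
  have h1 := this.tendsto y
  simpa [Real.zero_rpow hγ.ne'] using h1

/-- The profile obtained by integrating a compactly supported function up to a Hölder level. -/
lemma isHolderProfile_intervalIntegral {w h : ℝ → ℝ} {M a c γ δ : ℝ} (hw : Continuous w)
    (hM : ∀ y, |w y| ≤ M) (hsupp : ∀ y, a < |y| → w y = 0) (hδ : 0 < δ) (hδγ : δ ≤ γ)
    (hc : 0 ≤ c) (hbd : ∀ x, |h x| ≤ c) (hh : ∀ x y, |h x - h y| ≤ c * |x - y| ^ γ) :
    IsHolderProfile (a + c) (M * (2 * c)) δ fun y ν => ∫ t in (0 : ℝ)..h ν, w (y - t) := by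
  have hM0 : 0 ≤ M := (abs_nonneg _).trans (hM 0)
  have hcont := continuous_of_abs_sub_le_rpow (hδ.trans_le hδγ) hh
  have hii : ∀ y p q, IntervalIntegrable (fun t => w (y - t)) volume p q := fun y p q =>
    (hw.comp (continuous_sub_left y)).intervalIntegrable p q
  have hle : ∀ y p q, |∫ t in p..q, w (y - t)| ≤ M * |q - p| := fun y p q =>
    (Real.norm_eq_abs _).symm.trans_le
      (intervalIntegral.norm_integral_le_of_norm_le_const fun t _ => hM _)
  refine ⟨?_, fun y ν => ?_, fun y ν hy => ?_, fun y ν ν' => ?_⟩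
  · exact intervalIntegral.continuous_parametric_intervalIntegral_of_continuous
      (f := fun z : ℝ × ℝ => fun t => w (z.1 - t)) (by fun_prop)
      (hcont.comp continuous_snd)
  · refine (hle y 0 (h ν)).trans (mul_le_mul_of_nonneg_left ?_ hM0)
    rw [sub_zero]
    linarith [hbd ν]
  · refine (intervalIntegral.integral_congr (g := fun _ => (0 : ℝ)) fun t ht => ?_).trans
      (by simp)
    refine hsupp _ ?_
    have h1 : |t| ≤ c := by
      have h2 := Set.abs_sub_left_of_mem_uIcc ht
      rw [sub_zero, sub_zero] at h2
      exact h2.trans (hbd ν)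
    have := abs_sub_abs_le_abs_sub y t
    linarith
  · rw [intervalIntegral.integral_interval_sub_left (hii _ _ _) (hii _ _ _)]
    refine (hle y _ _).trans ?_
    rw [mul_assoc]
    exact mul_le_mul_of_nonneg_left (abs_sub_le_rpow_of_le hc hδ.le hδγ hbd hh ν ν') hM0

/-- Sums of `(1 + |p - j|) ^ (-r)` over `j ∈ ℤ` are bounded uniformly in `p`. -/
lemma exists_tsum_one_add_abs_sub_rpow_le {r : ℝ} (hr : 1 < r) :
    ∃ S, 0 ≤ S ∧ ∀ p : ℝ, Summable (fun j : ℤ => (1 + |p - j|) ^ (-r)) ∧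
      ∑' j : ℤ, (1 + |p - j|) ^ (-r) ≤ S := by
  have hsum : Summable fun k : ℤ => 2 ^ r * (1 + |(k : ℝ)|) ^ (-r) := by
    refine Summable.mul_left _ ?_
    refine (Real.summable_abs_int_rpow hr).of_norm_bounded_eventually ?_
    have : ∀ᶠ k : ℤ in cofinite, k ≠ 0 := by
      simpa using (Set.finite_singleton (0 : ℤ)).compl_mem_cofinite
    filter_upwards [this] with k hk
    rw [Real.norm_of_nonneg (by positivity)]
    refine Real.rpow_le_rpow_of_nonpos (by positivity) (by linarith) (by linarith)
  refine ⟨∑' k : ℤ, 2 ^ r * (1 + |(k : ℝ)|) ^ (-r), tsum_nonneg fun k => by positivity, ?_⟩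
  intro p
  have hle : ∀ k : ℤ, (1 + |p - ((k + ⌊p⌋ : ℤ) : ℝ)|) ^ (-r) ≤
      2 ^ r * (1 + |(k : ℝ)|) ^ (-r) := by
    intro k
    have h1 : (1 + |(k : ℝ)|) / 2 ≤ 1 + |p - ((k + ⌊p⌋ : ℤ) : ℝ)| := by
      have e : p - ((k + ⌊p⌋ : ℤ) : ℝ) = Int.fract p - k := by
        rw [Int.cast_add, ← Int.self_sub_floor]; ring
      rw [e, abs_sub_comm]
      have h2 := abs_sub_abs_le_abs_sub (k : ℝ) (Int.fract p)
      rw [abs_of_nonneg (Int.fract_nonneg p)] at h2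
      have h3 := (Int.fract_lt_one p).le
      have h4 := abs_nonneg ((k : ℝ) - Int.fract p)
      linarith
    refine (Real.rpow_le_rpow_of_nonpos (by positivity) h1 (by linarith)).trans_eq ?_
    rw [Real.div_rpow (by positivity) (by norm_num), Real.rpow_neg (by norm_num : (0:ℝ) ≤ 2),
      div_inv_eq_mul, mul_comm]
  have hs : Summable fun k : ℤ => (1 + |p - ((k + ⌊p⌋ : ℤ) : ℝ)|) ^ (-r) :=
    Summable.of_nonneg_of_le (fun k => by positivity) hle hsum
  constructor
  · exact (Equiv.summable_iff (Equiv.addRight ⌊p⌋)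
      (f := fun j : ℤ => (1 + |p - j|) ^ (-r))).1 hs
  · rw [← Equiv.tsum_eq (Equiv.addRight ⌊p⌋)]
    exact hs.tsum_le_tsum hle hsum

lemma sum_range_inv_sq_mul_inv_sqrt_le {P : ℝ} (hP : 0 < P) (N : ℕ) :
    ∑ n ∈ Finset.range N, 1 / (P + (n + 1)) ^ 2 * (1 / √(n + 1)) ≤ 2 / (P * √P) := by
  set F : ℕ → ℝ := fun n => √(n / (P + n)) with hF
  have hstep : ∀ n : ℕ, 1 / (P + (n + 1)) ^ 2 * (1 / √(n + 1)) ≤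
      2 / (P * √P) * (F (n + 1) - F n) := by
    intro n
    have hn : (0 : ℝ) ≤ n := n.cast_nonneg
    have ha : F (n + 1) ^ 2 = (n + 1) / (P + (n + 1)) := by
      simp only [hF, Nat.cast_add, Nat.cast_one]
      exact Real.sq_sqrt (by positivity)
    have hb : F n ^ 2 = n / (P + n) := Real.sq_sqrt (by positivity)
    have ha' : F (n + 1) = √(n + 1) / √(P + (n + 1)) := by
      simp only [hF, Nat.cast_add, Nat.cast_one]
      exact Real.sqrt_div (by positivity) _
    have hb0 : 0 ≤ F n := Real.sqrt_nonneg _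
    have ha0 : 0 < F (n + 1) := by rw [ha']; positivity
    have hdiff : F (n + 1) ^ 2 - F n ^ 2 = P / ((P + (n + 1)) * (P + n)) := by
      rw [ha, hb, div_sub_div _ _ (by positivity) (by positivity)]
      ring
    have hPn : 0 < P + n := by positivity
    have h1 : P / (P + (n + 1)) ^ 2 ≤ F (n + 1) ^ 2 - F n ^ 2 := by
      rw [hdiff]
      refine div_le_div_of_nonneg_left hP.le (by positivity) ?_
      rw [sq]
      exact mul_le_mul_of_nonneg_left (by linarith) (by positivity)
    have hmono : F n ≤ F (n + 1) := by
      have : 0 ≤ P / (P + (n + 1)) ^ 2 := by positivity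
      exact le_of_sq_le_sq (by linarith) ha0.le
    have h2 : P / (P + (n + 1)) ^ 2 ≤ 2 * F (n + 1) * (F (n + 1) - F n) := by nlinarith
    have h3 : √P ≤ √(P + (n + 1)) := Real.sqrt_le_sqrt (by linarith)
    have hsP : 0 < √P := Real.sqrt_pos.2 hP
    have hs1 : 0 < √((n : ℝ) + 1) := Real.sqrt_pos.2 (by positivity)
    have hs2 : 0 < √(P + (n + 1)) := hsP.trans_le h3
    have h4 : F (n + 1) * √P ≤ √(n + 1) := by
      rw [ha', div_mul_eq_mul_div, div_le_iff₀ hs2]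
      exact mul_le_mul_of_nonneg_left h3 hs1.le
    have h5 : P / (P + (n + 1)) ^ 2 * √P ≤ 2 * √(n + 1) * (F (n + 1) - F n) :=
      calc _ ≤ 2 * F (n + 1) * (F (n + 1) - F n) * √P :=
            mul_le_mul_of_nonneg_right h2 hsP.le
        _ = 2 * (F (n + 1) * √P) * (F (n + 1) - F n) := by ring
        _ ≤ _ := by
          have := sub_nonneg.2 hmono
          gcongr
    have h6 : 1 / (P + ((n : ℝ) + 1)) ^ 2 * (1 / √(n + 1)) =
        (P / (P + (n + 1)) ^ 2 * √P) / (P * √P * √(n + 1)) := by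
      field_simp
    rw [h6, div_le_iff₀ (by positivity)]
    refine h5.trans_eq ?_
    field_simp
  refine (Finset.sum_le_sum fun n _ => hstep n).trans ?_
  rw [← Finset.mul_sum, Finset.sum_range_sub]
  have hF0 : F 0 = 0 := by simp [hF]
  have hF1 : F N ≤ 1 := by
    rw [hF, Real.sqrt_le_one, div_le_one (by positivity)]
    linarith
  rw [hF0, sub_zero]
  exact mul_le_of_le_one_right (by positivity) hF1

lemma abs_tsum_convolution_le_of_neg {K g : ℝ → ℝ} {CK Cg : ℝ} {m : ℕ} (hCK : 0 ≤ CK)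
    (hCg : 0 ≤ Cg) (hK : ∀ t, |K t| ≤ CK / (1 + |t|) ^ 2) (hg0 : ∀ x < -(m : ℝ), g x = 0)
    (hg : ∀ x ≥ -(m : ℝ), |g x| ≤ Cg / √(x + m + 2)) {p q : ℝ} (hp : p ≤ -(2 * m + 1))
    (hq : q ∈ Set.Ico (0 : ℝ) 1) :
    |∑' j : ℤ, K (p - j) * g (j - q)| ≤ 8 * (CK * Cg) * |p| ^ (-(3 : ℝ) / 2) := by
  set f : ℤ → ℝ := fun j => K (p - j) * g (j - q) with hf
  have hp0 : p < 0 := by have : (0 : ℝ) ≤ m := m.cast_nonneg; linarith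
  rw [abs_of_neg hp0]
  set P := -p with hP
  have hP0 : 0 < P := by linarith
  have hinj : Function.Injective fun n : ℕ => (n : ℤ) - m := fun a b h => by
    simpa using h
  have hsupp : Function.support f ⊆ Set.range fun n : ℕ => (n : ℤ) - m := by
    intro j hj
    have hjm : -(m : ℤ) ≤ j := by
      by_contra! h
      refine hj ?_
      have h' : (j : ℝ) < -(m : ℝ) := by exact_mod_cast h
      rw [hf]
      simp only
      rw [hg0 _ (by linarith [hq.1]), mul_zero]
    exact ⟨(j + m).toNat, by simp only; omega⟩
  rw [← hinj.tsum_eq hsupp]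
  have hle : ∀ n : ℕ, ‖f ((n : ℤ) - m)‖ ≤
      CK * Cg * (1 / (P / 2 + (n + 1)) ^ 2 * (1 / √(n + 1))) := by
    intro n
    have hn : (0 : ℝ) ≤ n := n.cast_nonneg
    have e : (((n : ℤ) - m : ℤ) : ℝ) = n - m := by push_cast; ring
    rw [hf, Real.norm_eq_abs, abs_mul, e]
    have h1 : P / 2 + (n + 1) ≤ 1 + |p - (n - m)| := by
      have := neg_le_abs (p - (n - m))
      linarith
    have h2 : |K (p - (n - m))| ≤ CK / (P / 2 + (n + 1)) ^ 2 :=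
      (hK _).trans (by gcongr)
    have h3 : |g (n - m - q)| ≤ Cg / √(n + 1) := by
      rcases lt_or_ge ((n : ℝ) - m - q) (-m) with h | h
      · rw [hg0 _ h, abs_zero]; positivity
      · refine (hg _ h).trans (div_le_div_of_nonneg_left hCg (by positivity) ?_)
        exact Real.sqrt_le_sqrt (by linarith [hq.2])
    refine (mul_le_mul h2 h3 (abs_nonneg _) (by positivity)).trans_eq ?_
    ring
  have hN : ∀ N, ∑ n ∈ Finset.range N, ‖f ((n : ℤ) - m)‖ ≤
      CK * Cg * (2 / (P / 2 * √(P / 2))) := fun N => by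
    refine (Finset.sum_le_sum fun n _ => hle n).trans ?_
    rw [← Finset.mul_sum]
    exact mul_le_mul_of_nonneg_left
      (sum_range_inv_sq_mul_inv_sqrt_le (half_pos hP0) N) (by positivity)
  have hnn : ∀ n : ℕ, 0 ≤ ‖f ((n : ℤ) - m)‖ := fun n => norm_nonneg _
  refine (norm_tsum_le_tsum_norm (summable_of_sum_range_le hnn hN)).trans
    ((Real.tsum_le_of_sum_range_le hnn hN).trans ?_)
  have hsP : 0 < √P := Real.sqrt_pos.2 hP0
  have h1 : √P / 2 ≤ √(P / 2) := by
    refine Real.le_sqrt_of_sq_le ?_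
    rw [div_pow, Real.sq_sqrt hP0.le]
    linarith
  have h2 : P ^ (-(3 : ℝ) / 2) = 1 / (P * √P) := by
    rw [Real.sqrt_eq_rpow, ← Real.rpow_one_add' hP0.le (by norm_num), one_div,
      ← Real.rpow_neg hP0.le]
    norm_num
  have h3 : 2 / (P / 2 * √(P / 2)) ≤ 8 * (1 / (P * √P)) := by
    rw [mul_one_div, div_le_div_iff₀ (by positivity) (by positivity)]
    nlinarith
  calc _ ≤ CK * Cg * (8 * (1 / (P * √P))) := mul_le_mul_of_nonneg_left h3 (by positivity)
    _ = _ := by rw [h2]; ring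

lemma abs_tsum_convolution_le_of_pos {K : ℝ → ℝ} {CK Cg s P₀ : ℝ} (hCK : 0 ≤ CK)
    (hCg : 0 ≤ Cg) (hs0 : 0 ≤ s) (hs1 : s < 1) (hP₀ : 0 < P₀)
    (hK : ∀ t, |K t| ≤ CK / (1 + |t|) ^ 2)
    (hK0 : ∀ t : ℝ, (Summable fun j : ℤ => K (t - j)) → ∑' j : ℤ, K (t - j) = 0) :
    ∃ C, 0 ≤ C ∧ ∀ g : ℝ → ℝ,
      (∀ p ≥ P₀, ∀ x, |g x - g p| ≤ Cg * ((1 + |x - p|) / p) ^ s) →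
      ∀ p ≥ P₀, ∀ q ∈ Set.Ico (0 : ℝ) 1,
      |∑' j : ℤ, K (p - j) * g (j - q)| ≤ C * p ^ (-s) := by
  obtain ⟨S, hS0, hS⟩ := exists_tsum_one_add_abs_sub_rpow_le (r := 2 - s) (by linarith)
  refine ⟨CK * (Cg * 2) * S, by positivity, fun g hg p hp q hq => ?_⟩
  have hp0 : 0 < p := by linarith
  have hsum := (hS p).1
  have hpow : ∀ j : ℤ, 1 / (1 + |p - j|) ^ 2 * (1 + |p - j|) ^ s =
      (1 + |p - j|) ^ (-(2 - s)) := fun j => by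
    have h0 : 0 < 1 + |p - j| := by positivity
    rw [neg_sub, Real.rpow_sub h0, Real.rpow_two]
    ring
  have hKs : Summable fun j : ℤ => K (p - j) := by
    refine Summable.of_norm_bounded (hsum.mul_left CK) fun j => ?_
    refine (hK (p - j)).trans ?_
    rw [← hpow, ← mul_assoc, mul_one_div]
    refine le_mul_of_one_le_right (by positivity) (Real.one_le_rpow ?_ hs0)
    linarith [abs_nonneg (p - (j : ℝ))]
  have hle : ∀ j : ℤ, ‖K (p - j) * (g (j - q) - g p)‖ ≤
      CK * (Cg * 2) * p ^ (-s) * (1 + |p - j|) ^ (-(2 - s)) := by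
    intro j
    have h0 : 0 ≤ |p - j| := abs_nonneg _
    have h1 : 1 + |j - q - p| ≤ 2 * (1 + |p - j|) := by
      have h2 : |j - q - p| ≤ |q| + |p - j| := by
        have h3 : (j : ℝ) - q - p = -(q + (p - j)) := by ring
        rw [h3, abs_neg]
        exact abs_add_le _ _
      rw [abs_of_nonneg hq.1] at h2
      linarith [hq.2]
    have h2 : |g (j - q) - g p| ≤ Cg * (2 * ((1 + |p - j|) ^ s * p ^ (-s))) := by
      refine (hg p hp (j - q)).trans (mul_le_mul_of_nonneg_left ?_ hCg)
      rw [Real.div_rpow (by positivity) hp0.le, Real.rpow_neg hp0.le, div_eq_mul_inv, ← mul_assoc]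
      refine mul_le_mul_of_nonneg_right ?_ (by positivity)
      refine (Real.rpow_le_rpow (by positivity) h1 hs0).trans ?_
      rw [Real.mul_rpow (by norm_num) (by positivity)]
      refine mul_le_mul_of_nonneg_right ?_ (by positivity)
      exact (Real.rpow_le_rpow_of_exponent_le (by norm_num) hs1.le).trans_eq (Real.rpow_one 2)
    rw [norm_mul]
    refine (mul_le_mul (hK (p - j)) h2 (abs_nonneg _) (by positivity)).trans_eq ?_
    rw [← hpow]
    ring
  have hb := hsum.mul_left (CK * (Cg * 2) * p ^ (-s))
  have hfs : Summable fun j : ℤ => K (p - j) * (g (j - q) - g p) :=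
    Summable.of_norm_bounded hb hle
  have e : ∑' j : ℤ, K (p - j) * g (j - q) = ∑' j : ℤ, K (p - j) * (g (j - q) - g p) := by
    have e1 : ∀ j : ℤ, K (p - j) * g (j - q) =
        K (p - j) * (g (j - q) - g p) + K (p - j) * g p := fun j => by ring
    rw [tsum_congr e1, hfs.tsum_add (hKs.mul_right _), tsum_mul_right, hK0 p hKs, zero_mul,
      add_zero]
  rw [e]
  refine (tsum_of_norm_bounded hb.hasSum hle).trans ?_
  rw [tsum_mul_left]
  calc _ ≤ CK * (Cg * 2) * p ^ (-s) * S := mul_le_mul_of_nonneg_left (hS p).2 (by positivity)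
    _ = _ := by ring

/-- decay of `Ψ_l(αt,p̂,q) = Σ_{j∈ℤ} (𝓗 ik')(p̂−j) g_l(ε^{1/2}αt, j−q)`:
with `δ = γ/(γ+1)` there exist `C > 0` and `P₀ ≥ 1`, uniform in
`|αt| < ε^{−1/2}a`, `q ∈ [0,1)` and sufficiently small `ε > 0`, with
`|Ψ_l| ≤ C|p̂|^{−3/2}` for `p̂ ≤ −P₀` and `|Ψ_l| ≤ C p̂^{−(1+δ)/2}` for `p̂ ≥ P₀`. -/
theorem stmt_4 (γ a c₀ ε₀ D R₀ : ℝ) (w ik Hikp : ℝ → ℝ) (H : ℝ → ℝ → ℝ)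
    (hγ : γ ∈ Set.Ioc (0:ℝ) 1) (ha : 0 < a) (hc₀ : 0 < c₀) (hε₀ : 0 < ε₀)
    (hR₀ : 0 < R₀)
    -- the detector aperture function w ∈ C₀²(ℝ), even, with ∫ w = 1
    (hw_even : ∀ p : ℝ, w (-p) = w p)
    (hw_supp : HasCompactSupport w)
    (hw_d1 : ∀ p : ℝ, DifferentiableAt ℝ w p)
    (hw_d2 : ∀ p : ℝ, DifferentiableAt ℝ (deriv w) p)
    (hw_bdd : ∃ M : ℝ, ∀ᵐ p : ℝ, |deriv (deriv w) p| ≤ M)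
    (hw_int : ∫ p : ℝ, w p = 1)
    -- the interpolation kernel ik ∈ C₀²(ℝ), even, exact up to order 1
    (hik_even : ∀ p : ℝ, ik (-p) = ik p)
    (hik_supp : HasCompactSupport ik)
    (hik_d1 : ∀ p : ℝ, DifferentiableAt ℝ ik p)
    (hik_d2 : ∀ p : ℝ, DifferentiableAt ℝ (deriv ik) p)
    (hik_bdd : ∃ M : ℝ, ∀ᵐ p : ℝ, |deriv (deriv ik) p| ≤ M)
    (hik_exact0 : ∀ u : ℝ, ∑' j : ℤ, ik (u - (j : ℝ)) = 1)
    (hik_exact1 : ∀ u : ℝ, ∑' j : ℤ, (j : ℝ) * ik (u - (j : ℝ)) = u)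
    -- Hikp is the Hilbert transform of ik'
    (hHikp : ∀ t : ℝ, Tendsto
      (fun δ : ℝ => ∫ s in {s : ℝ | δ < |t - s|}, deriv ik s / (t - s))
      (𝓝[>] (0:ℝ)) (𝓝 (Real.pi * Hikp t)))
    -- the perturbation family: H1 and H2
    (hH1 : ∀ ε ∈ Set.Ioo (0:ℝ) ε₀, ∀ s : ℝ, |H ε s| ≤ c₀ * ε)
    (hH2 : ∀ ε ∈ Set.Ioo (0:ℝ) ε₀, ∀ s h : ℝ, 0 < h →
      |H ε (s + Real.sqrt ε * h) - H ε s| ≤ c₀ * ε * h ^ γ)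
    -- the leading term g_l
    (gl : ℝ → ℝ → ℝ → ℝ)
    (hgl : ∀ ε α p : ℝ, gl ε α p = D * R₀ *
      ∫ ν : ℝ, ∫ t in (0:ℝ)..(ε⁻¹ * H ε (α + Real.sqrt ε * ν)),
        w (p - R₀ / 2 * ν ^ 2 - t))
    -- Ψ_l
    (Psil : ℝ → ℝ → ℝ → ℝ → ℝ)
    (hPsil : ∀ ε αt p q : ℝ, Psil ε αt p q =
      ∑' j : ℤ, Hikp (p - (j : ℝ)) * gl ε (Real.sqrt ε * αt) ((j : ℝ) - q)) :
    ∃ C P₀ : ℝ, 0 < C ∧ 1 ≤ P₀ ∧ ∃ ε₁ : ℝ, 0 < ε₁ ∧ ε₁ ≤ ε₀ ∧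
      ∀ ε ∈ Set.Ioo (0:ℝ) ε₁, ∀ αt : ℝ, |αt| < a / Real.sqrt ε →
        ∀ q ∈ Set.Ico (0:ℝ) 1,
          (∀ p : ℝ, p ≤ -P₀ → |Psil ε αt p q| ≤ C * |p| ^ (-(3:ℝ)/2)) ∧
          (∀ p : ℝ, P₀ ≤ p → |Psil ε αt p q| ≤
            C * p ^ (-(1 + γ / (γ + 1)) / 2)) := by
  have hc₀' := hc₀.le
  obtain ⟨Mi, hMi⟩ := hik_bdd
  -- the interpolation kernel
  obtain ⟨r, hr⟩ := hik_supp.isCompact.isBounded.subset_closedBall (0 : ℝ)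
  obtain ⟨L, hL⟩ := exists_nat_gt (max r 1)
  have hL1 : (1 : ℝ) ≤ L := (le_max_right _ _).trans hL.le
  have hLr : r < L := (le_max_left _ _).trans_lt hL
  have hnot : ∀ s : ℝ, (L : ℝ) ≤ |s| → s ∉ tsupport ik := fun s hs h => by
    have := hr h
    rw [mem_closedBall_zero_iff, Real.norm_eq_abs] at this
    linarith
  have hik0 : ∀ s : ℝ, (L : ℝ) ≤ |s| → ik s = 0 := fun s hs => image_eq_zero_of_notMem_tsupport (hnot s hs)
  have hik0' : ∀ s : ℝ, (L : ℝ) ≤ |s| → deriv ik s = 0 := fun s hs => deriv_of_notMem_tsupport (hnot s hs)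
  have hlip := abs_sub_le_of_ae_abs_deriv_le hik_d2 hMi
  have hMi0 : 0 ≤ Mi := by simpa using (abs_nonneg _).trans (hlip 1 0)
  have hdcont : Continuous (deriv ik) :=
    continuous_iff_continuousAt.2 fun x => (hik_d2 x).continuousAt
  have hmean : ∫ s in Set.Icc (-(L : ℝ)) L, deriv ik s = 0 := by
    rw [integral_Icc_eq_integral_Ioc, ← intervalIntegral.integral_of_le (by linarith),
      intervalIntegral.integral_deriv_eq_sub (fun x _ => hik_d1 x)
        (hdcont.intervalIntegrable _ _), hik0 _ (le_abs_self _),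
      hik0 _ (by rw [abs_neg]; exact le_abs_self _), sub_zero]
  obtain ⟨CK, hCK, hK⟩ := hilbert_decay hL1 hMi0 hlip hik0' hmean hHikp
  have hK0 := fun t : ℝ => tsum_hilbert_translates_eq_zero hdcont hik0'
    (sum_deriv_translates_eq_zero hik_d1 hik0 hik_exact0) hHikp t
  -- the aperture function
  have hwcont : Continuous w := continuous_iff_continuousAt.2 fun x => (hw_d1 x).continuousAt
  obtain ⟨Mw, hMw⟩ := hw_supp.exists_bound_of_continuous hwcont
  have hMw0 : 0 ≤ Mw := (norm_nonneg _).trans (hMw 0)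
  obtain ⟨r', hr'⟩ := hw_supp.isCompact.isBounded.subset_closedBall (0 : ℝ)
  obtain ⟨m, hm⟩ := exists_nat_gt (max (r' + c₀) 1)
  have hm1 : (1 : ℝ) ≤ m := (le_max_right _ _).trans hm.le
  have hmr : r' + c₀ < m := (le_max_left _ _).trans_lt hm
  have hw0 : ∀ y : ℝ, m - c₀ < |y| → w y = 0 := fun y hy => by
    refine image_eq_zero_of_notMem_tsupport fun h => ?_
    have := hr' h
    rw [mem_closedBall_zero_iff, Real.norm_eq_abs] at this
    linarith
  -- the exponents
  have hγ0 : 0 < γ := hγ.1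
  set δ := γ / (γ + 1) with hδ
  have hδ0 : 0 < δ := by positivity
  have hδγ : δ ≤ γ := div_le_self hγ0.le (by linarith)
  have hδ1 : δ < 1 := by rw [hδ, div_lt_one (by linarith)]; linarith
  have hA : 0 ≤ Mw * (2 * c₀) := by positivity
  obtain ⟨Cg, hCg, hg⟩ := IsHolderProfile.exists_bound (b := m) hm1 hA hδ0 hδ1.le (half_pos hR₀)
  have hCg' : 0 ≤ |D * R₀| * Cg := by positivity
  obtain ⟨Cp, hCp, hpos⟩ := abs_tsum_convolution_le_of_pos (K := Hikp) (P₀ := 4 * m)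
    (s := (1 + δ) / 2) hCK hCg' (by linarith) (by linarith) (by linarith) hK hK0
  refine ⟨8 * (CK * (|D * R₀| * Cg)) + Cp + 1, 4 * m, by positivity, by linarith, ε₀, hε₀, le_rfl,
    fun ε hε αt _ q hq => ?_⟩
  have hε0 : 0 < ε := hε.1
  set h : ℝ → ℝ := fun ν => ε⁻¹ * H ε (√ε * αt + √ε * ν) with hh
  have hbd : ∀ x, |h x| ≤ c₀ := fun x => by
    rw [hh, abs_mul, abs_of_pos (inv_pos.2 hε0), inv_mul_le_iff₀ hε0, mul_comm ε]
    exact hH1 ε hε _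
  have hhol' : ∀ x y, y < x → |h x - h y| ≤ c₀ * |x - y| ^ γ := fun x y hxy => by
    have h1 := hH2 ε hε (√ε * αt + √ε * y) (x - y) (sub_pos.2 hxy)
    have h2 : √ε * αt + √ε * y + √ε * (x - y) = √ε * αt + √ε * x := by ring
    rw [h2] at h1
    simp only [hh]
    rw [← mul_sub, abs_mul, abs_of_pos (inv_pos.2 hε0), inv_mul_le_iff₀ hε0,
      abs_of_pos (sub_pos.2 hxy)]
    linarith
  have hhol : ∀ x y, |h x - h y| ≤ c₀ * |x - y| ^ γ := fun x y => by
    rcases lt_trichotomy x y with h1 | h1 | h1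
    · rw [abs_sub_comm, abs_sub_comm x]
      exact hhol' y x h1
    · rw [h1, sub_self, abs_zero]; positivity
    · exact hhol' x y h1
  have hB := isHolderProfile_intervalIntegral hwcont hMw hw0 hδ0 hδγ hc₀' hbd hhol
  rw [sub_add_cancel] at hB
  obtain ⟨g0, g1, g2⟩ := hg _ hB
  have hgl' := hgl ε (√ε * αt)
  have hneg := fun (p : ℝ) (hp : p ≤ -(2 * m + 1)) => abs_tsum_convolution_le_of_neg
    (K := Hikp) (g := gl ε (√ε * αt)) hCK hCg' hK
    (fun x hx => by rw [hgl', g0 x hx, mul_zero])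
    (fun x hx => by
      rw [hgl', abs_mul, mul_div_assoc]
      exact mul_le_mul_of_nonneg_left (g1 x hx) (abs_nonneg _)) hp hq
  have hpos' := hpos (gl ε (√ε * αt)) (fun p hp x => by
    rw [hgl', hgl', ← mul_sub, abs_mul, mul_assoc]
    exact mul_le_mul_of_nonneg_left (g2 p hp x) (abs_nonneg _))
  have hT : 0 ≤ 8 * (CK * (|D * R₀| * Cg)) := by positivity
  refine ⟨fun p hp => ?_, fun p hp => ?_⟩
  · rw [hPsil]
    refine (hneg p (by linarith)).trans (mul_le_mul_of_nonneg_right (by linarith) ?_)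
    positivity
  · rw [hPsil, neg_div]
    have hp0 : 0 ≤ p := by linarith
    refine (hpos' p hp q hq).trans (mul_le_mul_of_nonneg_right (by linarith) ?_)
    positivity
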